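/- Let r ≥ 10 and, for k ≥ 1, let O_k = B¹_k \ {(k,0), (−k,0), (0,k), (0,−k)} ⊆ ℤ² (the ℓ1-ball of radius k with its four corner points removed). Then there is a cycle in the grid graph ℤ² — a cyclic sequence of at least four distinct vertices in which consecutive vertices, and also the last and first vertices, are adjacent — all of whose vertices lie in O_{r−1} \ O_{r−3}, and which passes through every vertex of O_{r−1} \ O_{r−2}. -/

import Mathlib

/-- Grid adjacency in `ℤ²`: `u` and `v` are adjacent iff `‖u - v‖₁ = 1`. -/
def Adj2 (u v : ℤ × ℤ) : Prop := |u.1 - v.1| + |u.2 - v.2| = 1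

/-- The `ℓ1`-norm of a point of `ℤ²`. -/
def norm1 (x : ℤ × ℤ) : ℤ := |x.1| + |x.2|

/-- The octagon `O_k`: the `ℓ1`-ball of radius `k` in `ℤ²` with its four corner
points `(±k, 0)`, `(0, ±k)` removed. -/
def Oct (k : ℤ) : Set (ℤ × ℤ) :=
  {x | norm1 x ≤ k} \ {(k, 0), (-k, 0), (0, k), (0, -k)}

/-- The `k`-th vertex of the staircase cycle of length `8 n`. -/
def stair (n : ℤ) (k : ℕ) : ℤ × ℤ :=
  if (k : ℤ) < 2 * n then (n - k / 2, (k + 1) / 2)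
  else if (k : ℤ) < 4 * n then (-((k - 2 * n + 1) / 2), n - (k - 2 * n) / 2)
  else if (k : ℤ) < 6 * n then (-(n - (k - 4 * n) / 2), -((k - 4 * n + 1) / 2))
  else ((k - 6 * n + 1) / 2, -(n - (k - 6 * n) / 2))

theorem mem_Oct_iff (k x y : ℤ) : (x, y) ∈ Oct k ↔
    (max x (-x) + max y (-y) ≤ k ∧ ¬ (x = k ∧ y = 0) ∧ ¬ (x = -k ∧ y = 0) ∧
      ¬ (x = 0 ∧ y = k) ∧ ¬ (x = 0 ∧ y = -k)) := by
  simp only [Oct, norm1, abs_eq_max_neg, Set.mem_sdiff, Set.mem_ofPred_eq, Set.mem_insert_iff,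
    Set.mem_singleton_iff, Prod.mk.injEq, not_or]

theorem stair_inj (n : ℤ) (a b : ℕ) (ha : (a : ℤ) < 8 * n) (hb : (b : ℤ) < 8 * n)
    (h : stair n a = stair n b) : a = b := by
  unfold stair at h
  split_ifs at h <;> rw [Prod.mk.injEq] at h <;> omega

theorem stair_adj (n : ℤ) (hn : 1 ≤ n) (a : ℕ) (ha : (a : ℤ) + 1 < 8 * n) :
    Adj2 (stair n a) (stair n (a + 1)) := by
  unfold stair Adj2
  simp only [abs_eq_max_neg]
  split_ifs <;> push_cast at * <;> omega

theorem stair_close (n : ℤ) (hn : 1 ≤ n) (a : ℕ) (ha : (a : ℤ) + 1 = 8 * n) :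
    Adj2 (stair n a) (stair n 0) := by
  unfold stair Adj2
  simp only [abs_eq_max_neg]
  split_ifs <;> push_cast at * <;> omega

theorem stair_mem (n : ℤ) (hn : 1 ≤ n) (a : ℕ) (ha : (a : ℤ) < 8 * n) :
    stair n a ∈ Oct (n + 1) \ Oct (n - 1) := by
  unfold stair
  split_ifs <;> rw [Set.mem_sdiff, mem_Oct_iff, mem_Oct_iff] <;> omega

theorem stair_surj (n : ℤ) (hn : 1 ≤ n) (x y : ℤ) (h : (x, y) ∈ Oct (n + 1) \ Oct n) :
    ∃ a : ℕ, (a : ℤ) < 8 * n ∧ stair n a = (x, y) := by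
  rw [Set.mem_sdiff, mem_Oct_iff, mem_Oct_iff] at h
  have key : ∀ k : ℤ, 0 ≤ k → k < 8 * n → stair n k.toNat = (x, y) →
      ∃ a : ℕ, (a : ℤ) < 8 * n ∧ stair n a = (x, y) :=
    fun k h0 h1 h2 => ⟨k.toNat, by omega, h2⟩
  by_cases h1 : 0 < x ∧ 0 ≤ y
  · refine key (n - x + y) (by omega) (by omega) ?_
    unfold stair
    split_ifs <;> rw [Prod.mk.injEq] <;> omega
  by_cases h2 : x ≤ 0 ∧ 0 < y
  · refine key (2 * n + (n - y - x)) (by omega) (by omega) ?_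
    unfold stair
    split_ifs <;> rw [Prod.mk.injEq] <;> omega
  by_cases h3 : x < 0 ∧ y ≤ 0
  · refine key (4 * n + (n + x - y)) (by omega) (by omega) ?_
    unfold stair
    split_ifs <;> rw [Prod.mk.injEq] <;> omega
  · refine key (6 * n + (n + y + x)) (by omega) (by omega) ?_
    unfold stair
    split_ifs <;> rw [Prod.mk.injEq] <;> omega

theorem statement12 (r : ℤ) (hr : 10 ≤ r) :
    ∃ (C : List (ℤ × ℤ)) (h : C ≠ []),
      4 ≤ C.length ∧ C.Nodup ∧ C.Chain' Adj2 ∧ Adj2 (C.getLast h) (C.head h) ∧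
      (∀ x ∈ C, x ∈ Oct (r - 1) \ Oct (r - 3)) ∧
      (∀ x ∈ Oct (r - 1) \ Oct (r - 2), x ∈ C) := by
  obtain ⟨n, rfl⟩ : ∃ n, r = n + 2 := ⟨r - 2, by ring⟩
  have e1 : n + 2 - 1 = n + 1 := by ring
  have e2 : n + 2 - 2 = n := by ring
  have e3 : n + 2 - 3 = n - 1 := by ring
  rw [e1, e2, e3]
  obtain ⟨N, hN⟩ : ∃ N : ℕ, (N : ℤ) = 8 * n := ⟨(8 * n).toNat, by omega⟩
  refine ⟨(List.range N).map (stair n), ?_, ?_, ?_, ?_, ?_, ?_, ?_⟩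
  · intro h
    have := congrArg List.length h
    simp at this
    omega
  · simp
    omega
  · refine List.Nodup.map_on ?_ List.nodup_range
    intro a ha b hb h
    rw [List.mem_range] at ha hb
    exact stair_inj n a b (by omega) (by omega) h
  · refine List.isChain_iff_getElem.2 ?_
    intro i hi
    simp at hi ⊢
    exact stair_adj n (by omega) i (by omega)
  · rw [List.getLast_eq_getElem, List.head_eq_getElem]
    simp
    exact stair_close n (by omega) _ (by omega)
  · intro x hx
    obtain ⟨a, ha, rfl⟩ := List.mem_map.1 hx
    rw [List.mem_range] at ha
    exact stair_mem n (by omega) a (by omega)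
  · rintro ⟨x, y⟩ hx
    obtain ⟨a, ha, h⟩ := stair_surj n (by omega) x y hx
    exact List.mem_map.2 ⟨a, List.mem_range.2 (by omega), h⟩
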